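/- Let I = (n_1, …, n_l) be a composition of n. The invariant ring P^{U_I} of the block unipotent group U_I is the polynomial algebra P^{U_I} = F_q[x_1, …, x_{n_1}, v_{2,1}, …, v_{2,n_2}, …, v_{l,1}, …, v_{l,n_l}]; in particular these n elements are algebraically independent over F_q and generate P^{U_I} as an F_q-algebra. -/

import Mathlib

open MvPolynomial Finset

/-- The action of a matrix `g` on `F_q[x_1, …, x_n]`: the algebra map sending
`x_j` to `Σ_i g_{ij} x_i`. -/
noncomputable def matAct {K : Type*} [Field K] {n : ℕ} (g : Matrix (Fin n) (Fin n) K) :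
    MvPolynomial (Fin n) K →ₐ[K] MvPolynomial (Fin n) K :=
  aeval fun j => ∑ i, C (g i j) * X i

/-- The subalgebra of polynomials invariant under every matrix in `G`. -/
noncomputable def invariants {K : Type*} [Field K] {n : ℕ} (G : Set (GL (Fin n) K)) :
    Subalgebra K (MvPolynomial (Fin n) K) where
  carrier := {f | ∀ g ∈ G, matAct ((g : GL (Fin n) K) : Matrix (Fin n) (Fin n) K) f = f}
  mul_mem' := by
    intro a b ha hb g hg
    rw [map_mul, ha g hg, hb g hg]
  add_mem' := by
    intro a b ha hb g hg
    rw [map_add, ha g hg, hb g hg]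
  algebraMap_mem' := by
    intro c g hg
    simp [matAct]

/-- The ideal generated by the homogeneous `G`-invariants of positive degree;
the quotient by it is the algebra of coinvariants. -/
noncomputable def coinvIdeal {K : Type*} [Field K] {n : ℕ} (G : Set (GL (Fin n) K)) :
    Ideal (MvPolynomial (Fin n) K) :=
  Ideal.span {f | f ∈ invariants G ∧ ∃ d, 0 < d ∧ f.IsHomogeneous d}

/-- `tauf m s` is the largest partial sum `m i` which is `≤ s`; for `s` in the
`(j+1)`-st block this is `m j`. -/
def tauf {l : ℕ} (m : Fin (l + 1) → ℕ) (s : ℕ) : ℕ :=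
  ((Finset.univ : Finset (Fin (l + 1))).filter fun i => m i ≤ s).sup m

/-- `U_I`: block upper triangular matrices whose diagonal blocks are identity
matrices (blocks determined by the partial sums `m`). -/
def USet (K : Type*) [Field K] {l : ℕ} (n : ℕ) (m : Fin (l + 1) → ℕ) :
    Set (GL (Fin n) K) :=
  {g | ∀ s t : Fin n, tauf m (t : ℕ) ≤ tauf m (s : ℕ) →
    (g : Matrix (Fin n) (Fin n) K) s t = if s = t then 1 else 0}

/-- The global index of the `j`-th variable of the `i`-th block. -/
def emb {l : ℕ} (n : ℕ) (m : Fin (l + 1) → ℕ) (hmono : StrictMono m)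
    (hlast : m (Fin.last l) = n) (i : Fin l)
    (j : Fin (m i.succ - m i.castSucc)) : Fin n :=
  ⟨m i.castSucc + (j : ℕ), by
    have h1 : m i.succ ≤ n := hlast ▸ hmono.monotone (Fin.le_last _)
    have h2 := j.2
    omega⟩

/-- `G_I`: block upper triangular matrices whose `i`-th diagonal block lies in
`G i` (and whose entries above the diagonal blocks are arbitrary). -/
def GSet (K : Type*) [Field K] {l : ℕ} (n : ℕ) (m : Fin (l + 1) → ℕ)
    (hmono : StrictMono m) (hlast : m (Fin.last l) = n)
    (G : (i : Fin l) → Subgroup (GL (Fin (m i.succ - m i.castSucc)) K)) :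
    Set (GL (Fin n) K) :=
  {g | (∀ s t : Fin n, tauf m (t : ℕ) < tauf m (s : ℕ) →
          (g : Matrix (Fin n) (Fin n) K) s t = 0) ∧
    ∀ i : Fin l, ∃ h ∈ G i, ∀ j k : Fin (m i.succ - m i.castSucc),
      (g : Matrix (Fin n) (Fin n) K) (emb n m hmono hlast i j) (emb n m hmono hlast i k) =
        (h : Matrix (Fin (m i.succ - m i.castSucc)) (Fin (m i.succ - m i.castSucc)) K) j k}

/-- `Fpoly K k hk t = Π_{(λ_1,…,λ_k) ∈ K^k} (t + λ_1 x_1 + ⋯ + λ_k x_k)`. -/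
noncomputable def Fpoly (K : Type*) [Field K] [Fintype K] {n : ℕ} (k : ℕ) (hk : k ≤ n)
    (t : MvPolynomial (Fin n) K) : MvPolynomial (Fin n) K :=
  ∏ c : Fin k → K, (t + ∑ i : Fin k, C (c i) * X (Fin.castLE hk i))

/-- `v_{i,j} = F_{m_{i-1}}(x_{m_{i-1}+j})`. -/
noncomputable def vij (K : Type*) [Field K] [Fintype K] {l : ℕ} (n : ℕ)
    (m : Fin (l + 1) → ℕ) (hmono : StrictMono m) (hlast : m (Fin.last l) = n)
    (i : Fin l) (j : Fin (m i.succ - m i.castSucc)) : MvPolynomial (Fin n) K :=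
  Fpoly K (m i.castSucc)
    (le_trans (hmono.monotone (Fin.le_last _)) (le_of_eq hlast))
    (X (emb n m hmono hlast i j))

/-- The linear form `c_1 x_1 + ⋯ + c_k x_k`. -/
noncomputable def initialForm {K : Type*} [Field K] {n k : ℕ} (hk : k ≤ n) (c : Fin k → K) :
    MvPolynomial (Fin n) K :=
  ∑ i : Fin k, C (c i) * X (Fin.castLE hk i)

/-- The algebra map sending `x_k` to `a` and fixing the other variables. -/
noncomputable def substVar {K : Type*} [Field K] {n : ℕ} (k : Fin n) (a : MvPolynomial (Fin n) K) :
    MvPolynomial (Fin n) K →ₐ[K] MvPolynomial (Fin n) K :=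
  aeval (Function.update X k a)

/-- The unipotent matrices differing from the identity in column `t` only in the first `τ t`
rows. -/
def staircaseUnipotent (K : Type*) [Field K] {n : ℕ} (τ : Fin n → ℕ) : Set (GL (Fin n) K) :=
  {g | ∀ s t : Fin n, τ t ≤ s → (g : Matrix (Fin n) (Fin n) K) s t = if s = t then 1 else 0}

section Staircase

variable {K : Type*} [Field K] {n : ℕ}

lemma initialForm_injective {k : ℕ} (hk : k ≤ n) :
    Function.Injective (initialForm hk : (Fin k → K) → MvPolynomial (Fin n) K) := by
  intro c d h
  ext i
  have := congrArg (eval (Pi.single (Fin.castLE hk i) (1 : K))) h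
  simpa [initialForm, Pi.single_apply] using this

lemma initialForm_add {k : ℕ} (hk : k ≤ n) (c d : Fin k → K) :
    (initialForm hk (c + d) : MvPolynomial (Fin n) K) = initialForm hk c + initialForm hk d := by
  simp only [initialForm, Pi.add_apply, C_add, add_mul, sum_add_distrib]

lemma substVar_X_self (k : Fin n) (a : MvPolynomial (Fin n) K) : substVar k a (X k) = a := by
  simp [substVar]

lemma substVar_X_of_ne {k i : Fin n} (h : i ≠ k) (a : MvPolynomial (Fin n) K) :
    substVar k a (X i) = X i := by
  simp [substVar, h]

lemma substVar_initialForm {d : ℕ} (k : Fin n) (hk : d ≤ n) (hd : d ≤ k)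
    (a : MvPolynomial (Fin n) K) (c : Fin d → K) :
    substVar k a (initialForm hk c) = initialForm hk c := by
  simp only [initialForm, map_sum, map_mul]
  refine sum_congr rfl fun i _ => ?_
  rw [substVar_X_of_ne]
  · simp [substVar]
  · intro h
    have := congrArg Fin.val h
    have := i.2
    simp at this
    grind

lemma algHom_congr_vars {f : MvPolynomial (Fin n) K}
    {φ ψ : MvPolynomial (Fin n) K →ₐ[K] MvPolynomial (Fin n) K}
    (h : ∀ i ∈ f.vars, φ (X i) = ψ (X i)) : φ f = ψ f := by
  refine hom_congr_vars (f₁ := (φ : MvPolynomial (Fin n) K →+* MvPolynomial (Fin n) K))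
    (f₂ := (ψ : MvPolynomial (Fin n) K →+* MvPolynomial (Fin n) K)) ?_ (fun i hi _ => h i hi) rfl
  ext c
  simp [← algebraMap_eq]

lemma X_sub_dvd_sub_substVar (k : Fin n) (a f : MvPolynomial (Fin n) K) :
    X k - a ∣ f - substVar k a f := by
  induction f using MvPolynomial.induction_on with
  | C c => simp [substVar]
  | add p q hp hq =>
    rw [map_add, add_sub_add_comm]
    exact dvd_add hp hq
  | mul_X p i hp =>
    have h : X k - a ∣ X i - substVar k a (X i) := by
      rcases eq_or_ne i k with rfl | h
      · rw [substVar_X_self]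
      · simp [substVar_X_of_ne h]
    rw [map_mul]
    exact dvd_mul_sub_mul hp h

lemma prod_X_sub_dvd {ι : Type*} (k : Fin n) (S : Finset ι) (a : ι → MvPolynomial (Fin n) K)
    (ha : Set.InjOn a S) (hfix : ∀ i ∈ S, ∀ b, substVar k b (a i) = a i)
    (f : MvPolynomial (Fin n) K) (hf : ∀ i ∈ S, substVar k (a i) f = 0) :
    ∏ i ∈ S, (X k - a i) ∣ f := by
  classical
  induction S using Finset.induction_on with
  | empty => simp
  | insert j S hj ih =>
    obtain ⟨Q, rfl⟩ := ih (ha.mono (by simp)) (fun i hi => hfix i (by simp [hi]))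
      (fun i hi => hf i (by simp [hi]))
    have h := hf j (by simp)
    have hS : substVar k (a j) (∏ i ∈ S, (X k - a i)) ≠ 0 := by
      rw [map_prod, prod_ne_zero_iff]
      intro i hi h0
      rw [map_sub, substVar_X_self, hfix i (by simp [hi]), sub_eq_zero] at h0
      exact hj (ha (by simp) (by simp [hi]) h0 ▸ hi)
    rw [map_mul, mul_eq_zero, or_iff_right hS] at h
    have := X_sub_dvd_sub_substVar k (a j) Q
    rw [h, sub_zero] at this
    rw [prod_insert hj, mul_comm]
    exact mul_dvd_mul_left _ this

lemma vars_substVar_zero (k : Fin n) (f : MvPolynomial (Fin n) K) :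
    (substVar k 0 f).vars ⊆ f.vars.erase k := by
  intro i hi
  obtain ⟨j, hj, hij⟩ := mem_vars_bind₁ (Function.update X k 0) f hi
  rcases eq_or_ne j k with rfl | h
  · simp at hij
  · rw [Function.update_of_ne h, vars_X, mem_singleton] at hij
    simpa [hij, h] using hj

lemma degreeOf_ne_zero_iff_mem_vars {i : Fin n} {f : MvPolynomial (Fin n) K} :
    degreeOf i f ≠ 0 ↔ i ∈ f.vars := by
  classical
  rw [degreeOf_def, vars_def, Multiset.mem_toFinset, Multiset.count_ne_zero]

lemma vars_right_subset_vars_mul {p q : MvPolynomial (Fin n) K} (hp : p ≠ 0) (hq : q ≠ 0) :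
    q.vars ⊆ (p * q).vars := by
  intro i hi
  rw [← degreeOf_ne_zero_iff_mem_vars] at hi ⊢
  rw [degreeOf_mul_eq hp hq]
  omega

variable {τ : Fin n → ℕ}

lemma matAct_X (g : Matrix (Fin n) (Fin n) K) (t : Fin n) :
    matAct g (X t) = ∑ i, C (g i t) * X i := by
  simp [matAct]

lemma matAct_mul (g h : Matrix (Fin n) (Fin n) K) (f : MvPolynomial (Fin n) K) :
    matAct (g * h) f = matAct g (matAct h f) := by
  rw [← AlgHom.comp_apply]
  congr 1
  ext1 t
  simp only [AlgHom.comp_apply, matAct_X, map_sum, map_mul, Matrix.mul_apply, sum_mul, mul_sum]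
  rw [sum_comm]
  refine sum_congr rfl fun i _ => sum_congr rfl fun j _ => ?_
  rw [← algebraMap_eq, AlgHom.commutes]
  simp only [algebraMap_eq]
  ring

lemma matAct_injective (g : GL (Fin n) K) :
    Function.Injective (matAct (g : Matrix (Fin n) (Fin n) K)) := by
  refine Function.LeftInverse.injective (g := matAct ((g⁻¹ : GL (Fin n) K) : Matrix _ _ K)) ?_
  intro f
  rw [← matAct_mul, ← Units.val_mul, inv_mul_cancel]
  have : matAct (1 : Matrix (Fin n) (Fin n) K) = AlgHom.id K _ := by
    ext1 t
    simp [matAct_X, Matrix.one_apply]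
  simp [this]

lemma sum_C_mul_X_eq_initialForm {k : ℕ} (hk : k ≤ n) (b : Fin n → K)
    (hb : ∀ i : Fin n, k ≤ i → b i = 0) :
    ∑ i, C (b i) * X i = initialForm hk fun j => b (Fin.castLE hk j) := by
  symm
  refine sum_of_injOn (Fin.castLE hk) (Fin.castLE_injective hk).injOn (by simp) ?_ (by simp)
  intro i _ hi
  rw [hb i, C_0, zero_mul]
  by_contra! h
  exact hi ⟨⟨i, h⟩, by simp⟩

lemma matAct_X_of_mem {g : GL (Fin n) K} (hg : g ∈ staircaseUnipotent K τ) (t : Fin n)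
    (ht : τ t ≤ n) :
    matAct (g : Matrix (Fin n) (Fin n) K) (X t) =
      X t + initialForm ht fun j => (g : Matrix (Fin n) (Fin n) K) (Fin.castLE ht j) t -
        if Fin.castLE ht j = t then 1 else 0 := by
  rw [matAct_X, ← sum_C_mul_X_eq_initialForm ht
    fun i => (g : Matrix (Fin n) (Fin n) K) i t - if i = t then 1 else 0]
  · simp only [C_sub, sub_mul, sum_sub_distrib]
    simp [apply_ite C, ite_mul]
  · intro i hi
    rw [hg i t hi, sub_self]

lemma matAct_initialForm_of_mem (hτ : ∀ t : Fin n, τ t ≤ t) {g : GL (Fin n) K}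
    (hg : g ∈ staircaseUnipotent K τ) (t : Fin n) (ht : τ t ≤ n) (c : Fin (τ t) → K) :
    ∃ d, matAct (g : Matrix (Fin n) (Fin n) K) (initialForm ht c) = initialForm ht d := by
  refine ⟨_, .trans ?_ (sum_C_mul_X_eq_initialForm ht
    (fun i => ∑ j : Fin (τ t), (g : Matrix (Fin n) (Fin n) K) i (Fin.castLE ht j) * c j) ?_)⟩
  · simp only [initialForm, map_sum, map_mul, matAct_X, mul_sum, sum_mul]
    rw [sum_comm]
    refine sum_congr rfl fun i _ => sum_congr rfl fun j _ => ?_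
    rw [← algebraMap_eq, AlgHom.commutes]
    ring
  · intro i hi
    refine sum_eq_zero fun j _ => ?_
    have hj := j.2
    have := hτ (Fin.castLE ht j)
    simp only [Fin.val_castLE] at this
    rw [hg _ _ (by omega), if_neg, zero_mul]
    rintro rfl
    simp at hi
    omega

/-- The substitution `x_k ↦ x_k + c_1 x_1 + c_2 x_2 + ⋯` is the action of a group element. -/
lemma exists_mem_staircaseUnipotent (k : Fin n) (hk : τ k ≤ n) (hkk : τ k ≤ k)
    (c : Fin (τ k) → K) :
    ∃ g ∈ staircaseUnipotent K τ, matAct (g : Matrix (Fin n) (Fin n) K) =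
      substVar k (X k + initialForm hk c) := by
  set b : Fin n → K := fun i => if h : (i : ℕ) < τ k then c ⟨i, h⟩ else 0 with hb
  set N : Matrix (Fin n) (Fin n) K := Matrix.vecMulVec b (Pi.single k 1) with hN
  have hbk : ∀ i : Fin n, τ k ≤ i → b i = 0 := fun i hi => by simp [hb, not_lt.mpr hi]
  have hNN : N * N = 0 := by
    ext i j
    simp [hN, Matrix.mul_apply, Matrix.vecMulVec_apply, Pi.single_apply, hbk k hkk]
  refine ⟨⟨1 + N, 1 - N, ?_, ?_⟩, ?_, ?_⟩
  · noncomm_ring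
    simp [hNN]
  · noncomm_ring
    simp [hNN]
  · intro s t hst
    rcases eq_or_ne t k with rfl | h
    · simp [hN, Matrix.one_apply, Matrix.vecMulVec_apply, hbk s hst]
    · simp [hN, Matrix.one_apply, Matrix.vecMulVec_apply, h]
  · ext1 t
    simp only [matAct_X, Matrix.add_apply, C_add, add_mul, sum_add_distrib]
    rcases eq_or_ne t k with rfl | h
    · rw [substVar_X_self]
      congr 1
      · simp [Matrix.one_apply]
      · simp only [hN, Matrix.vecMulVec_apply, Pi.single_eq_same, mul_one]
        rw [sum_C_mul_X_eq_initialForm hk b hbk]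
        simp [hb]
    · rw [substVar_X_of_ne h]
      simp [hN, Matrix.one_apply, Matrix.vecMulVec_apply, h]

lemma substVar_eq_of_mem_invariants {f : MvPolynomial (Fin n) K}
    (hf : f ∈ invariants (staircaseUnipotent K τ)) (k : Fin n) (hk : τ k ≤ n) (hkk : τ k ≤ k)
    (c : Fin (τ k) → K) : substVar k (initialForm hk c) f = substVar k 0 f := by
  obtain ⟨g, hg, h⟩ := exists_mem_staircaseUnipotent k hk hkk c
  conv_rhs => rw [← hf g hg, h]
  rw [← AlgHom.comp_apply]
  congr 1
  ext1 t
  rw [AlgHom.comp_apply]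
  rcases eq_or_ne t k with rfl | h
  · simp [substVar_X_self, substVar_initialForm _ hk hkk]
  · simp [substVar_X_of_ne h]

/-- Setting the last occurring variable to zero preserves invariance. -/
lemma substVar_zero_mem_invariants (hτ : ∀ t : Fin n, τ t ≤ t) {f : MvPolynomial (Fin n) K}
    (hf : f ∈ invariants (staircaseUnipotent K τ)) (k : Fin n) (hv : ∀ i ∈ f.vars, i ≤ k) :
    substVar k 0 f ∈ invariants (staircaseUnipotent K τ) := by
  intro g hg
  have hk : τ k ≤ n := (hτ k).trans k.2.le
  have h := matAct_X_of_mem hg k hk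
  set d : Fin (τ k) → K := _
  change _ = X k + initialForm hk d at h
  have hneg : initialForm hk (-d) = -initialForm hk d := by
    simp [initialForm]
  rw [← substVar_eq_of_mem_invariants hf k hk (hτ k) (-d)]
  conv_rhs => rw [← hf g hg]
  rw [substVar_eq_of_mem_invariants hf k hk (hτ k) (-d)]
  simp only [← AlgHom.comp_apply]
  refine algHom_congr_vars fun i hi => ?_
  simp only [AlgHom.comp_apply]
  rcases eq_or_ne i k with rfl | hik
  · rw [h, map_add, substVar_X_self, substVar_X_self, substVar_initialForm _ hk (hτ i), hneg,
      map_zero, neg_add_cancel]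
  · have hi' : τ i ≤ n := (hτ i).trans i.2.le
    rw [substVar_X_of_ne hik, matAct_X_of_mem hg i hi', map_add, substVar_X_of_ne hik,
      substVar_initialForm _ hi' ((hτ i).trans (hv i hi))]

variable [Fintype K]

lemma Fpoly_eq {k : ℕ} (hk : k ≤ n) (t : MvPolynomial (Fin n) K) :
    Fpoly K k hk t = ∏ c, (t + initialForm hk c) := rfl

lemma Fpoly_eq_prod_sub {k : ℕ} (hk : k ≤ n) (t : MvPolynomial (Fin n) K) :
    Fpoly K k hk t = ∏ c, (t - initialForm hk c) := by
  rw [Fpoly_eq, ← Equiv.prod_comp (Equiv.neg (Fin k → K))]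
  refine prod_congr rfl fun c _ => ?_
  simp [initialForm, sub_eq_add_neg]

lemma Fpoly_X_ne_zero {d : ℕ} (hd : d ≤ n) (k : Fin n) (hdk : d ≤ k) :
    Fpoly K d hd (X k) ≠ 0 := by
  rw [Fpoly_eq, prod_ne_zero_iff]
  intro c _ h
  have := congrArg (substVar k (1 - initialForm hd c)) h
  simp [substVar_X_self, substVar_initialForm k hd hdk] at this

lemma mem_vars_Fpoly_X {d : ℕ} (hd : d ≤ n) (k : Fin n) (hdk : d ≤ k) :
    k ∈ (Fpoly K d hd (X k)).vars := by
  by_contra h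
  have h1 : substVar k 0 (Fpoly K d hd (X k)) = AlgHom.id K _ (Fpoly K d hd (X k)) :=
    algHom_congr_vars fun i hi => by
      rw [substVar_X_of_ne (by rintro rfl; exact h hi)]
      rfl
  refine Fpoly_X_ne_zero (K := K) hd k hdk (h1.symm.trans ?_)
  rw [Fpoly_eq, map_prod, prod_eq_zero_iff]
  exact ⟨0, mem_univ _, by simp [substVar_X_self, initialForm]⟩

lemma Fpoly_mem_invariants (hτ : ∀ t : Fin n, τ t ≤ t) (t : Fin n) (ht : τ t ≤ n) :
    Fpoly K (τ t) ht (X t) ∈ invariants (staircaseUnipotent K τ) := by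
  intro g hg
  have key : ∀ c : Fin (τ t) → K, ∃ d, matAct (g : Matrix (Fin n) (Fin n) K)
      (X t + initialForm ht c) = X t + initialForm ht d := by
    intro c
    obtain ⟨d, hd⟩ := matAct_initialForm_of_mem hτ hg t ht c
    rw [map_add, hd, matAct_X_of_mem hg t ht, add_assoc]
    exact ⟨_, congrArg (X t + ·) (initialForm_add ht _ d).symm⟩
  choose φ hφ using key
  have hinj : Function.Injective φ := by
    intro c d h
    apply initialForm_injective ht
    apply add_left_cancel (a := X t)
    apply matAct_injective g
    rw [hφ, hφ, h]
  rw [Fpoly_eq, map_prod]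
  simp_rw [hφ]
  exact hinj.bijective_of_finite.prod_comp fun c => X t + initialForm ht c

lemma mem_adjoin_of_mem_invariants (hn : ∀ t, τ t ≤ n) (hτ : ∀ t : Fin n, τ t ≤ t)
    (k : ℕ) (f : MvPolynomial (Fin n) K)
    (hf : f ∈ invariants (staircaseUnipotent K τ)) (hv : ∀ i ∈ f.vars, (i : ℕ) < k) :
    f ∈ Algebra.adjoin K (Set.range fun t => Fpoly K (τ t) (hn t) (X t)) := by
  induction k generalizing f with
  | zero =>
    have : f.vars = ∅ := eq_empty_of_forall_notMem fun i hi => by simpa using hv i hi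
    rw [vars_eq_empty_iff_eq_C] at this
    rw [this]
    exact Subalgebra.algebraMap_mem _ _
  | succ k ih =>
    by_cases hkn : n ≤ k
    · exact ih f hf fun i _ => i.2.trans_le hkn
    obtain ⟨κ, rfl⟩ : ∃ κ : Fin n, (κ : ℕ) = k := ⟨⟨k, not_le.mp hkn⟩, rfl⟩
    induction hd : f.degreeOf κ using Nat.strong_induction_on generalizing f with
    | h d ihd =>
    have hv0 := vars_substVar_zero κ f
    have hf0 := substVar_zero_mem_invariants hτ hf κ
      fun i hi => Fin.le_def.mpr (Nat.lt_succ_iff.mp (hv i hi))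
    have hA := ih _ hf0 fun i hi => by
      have h1 := mem_erase.mp (hv0 hi)
      have h2 := hv i h1.2
      have h3 : (i : ℕ) ≠ κ := fun h => h1.1 (Fin.ext h)
      omega
    have hdvd : Fpoly K (τ κ) (hn κ) (X κ) ∣ f - substVar κ 0 f := by
      rw [Fpoly_eq_prod_sub]
      refine prod_X_sub_dvd κ univ _ (initialForm_injective (hn κ)).injOn
        (fun c _ b => substVar_initialForm κ (hn κ) (hτ κ) b c) _ fun c _ => ?_
      rw [map_sub, substVar_eq_of_mem_invariants hf κ (hn κ) (hτ κ), sub_eq_zero]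
      have : AlgHom.id K _ (substVar κ 0 f) =
          substVar κ (initialForm (hn κ) c) (substVar κ 0 f) :=
        algHom_congr_vars fun i hi => by
          rw [substVar_X_of_ne (mem_erase.mp (hv0 hi)).1]
          rfl
      exact this
    obtain ⟨Q, hQ⟩ := hdvd
    rw [sub_eq_iff_eq_add] at hQ
    have hw0 := Fpoly_X_ne_zero (K := K) (hn κ) κ (hτ κ)
    have hwinv := Fpoly_mem_invariants (K := K) hτ κ (hn κ)
    have hwA : Fpoly K (τ κ) (hn κ) (X κ) ∈
        Algebra.adjoin K (Set.range fun t => Fpoly K (τ t) (hn t) (X t)) :=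
      Algebra.subset_adjoin ⟨κ, rfl⟩
    have hwdeg := degreeOf_ne_zero_iff_mem_vars.mpr (mem_vars_Fpoly_X (K := K) (hn κ) κ (hτ κ))
    set w := Fpoly K (τ κ) (hn κ) (X κ)
    rw [hQ]
    refine add_mem (mul_mem hwA ?_) hA
    rcases eq_or_ne Q 0 with rfl | hQ0
    · exact zero_mem _
    have hwQ : w * Q = f - substVar κ 0 f := eq_sub_of_add_eq hQ.symm
    have hdeg0 : degreeOf κ (substVar κ 0 f) = 0 := by
      by_contra h
      exact (mem_erase.mp (hv0 (degreeOf_ne_zero_iff_mem_vars.mp h))).1 rfl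
    refine ihd (degreeOf κ Q) ?_ Q ?_ ?_ rfl
    · have h1 := degreeOf_sub_le κ f (substVar κ 0 f)
      rw [← hwQ, degreeOf_mul_eq hw0 hQ0, hdeg0, hd] at h1
      simp at h1
      omega
    · intro g hg
      apply mul_left_cancel₀ hw0
      conv_lhs => rw [← hwinv g hg]
      rw [← map_mul, hwQ, map_sub, hf g hg, hf0 g hg]
    · intro i hi
      have h1 := vars_right_subset_vars_mul hw0 hQ0 hi
      rw [hwQ] at h1
      rcases mem_union.mp (vars_sub_subset f h1) with h | h
      · exact hv i h
      · exact hv i (mem_erase.mp (hv0 h)).2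

lemma isIntegral_of_isIntegral_integralClosure {R A : Type*} [CommRing R] [CommRing A]
    [Algebra R A] {x : A} (hx : IsIntegral (integralClosure R A) x) : IsIntegral R x :=
  isIntegral_trans (A := integralClosure R A) x hx

lemma isIntegral_X_adjoin_Fpoly (hn : ∀ t, τ t ≤ n) (hτ : ∀ t : Fin n, τ t ≤ t) (k : Fin n) :
    IsIntegral (Algebra.adjoin K (Set.range fun t => Fpoly K (τ t) (hn t) (X t)))
      (X k : MvPolynomial (Fin n) K) := by
  induction hk : (k : ℕ) using Nat.strong_induction_on generalizing k with
  | h d ih =>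
  set A := Algebra.adjoin K (Set.range fun t => Fpoly K (τ t) (hn t) (X t))
  have hmem : ∀ i : Fin (τ k), (X (Fin.castLE (hn k) i) : MvPolynomial (Fin n) K) ∈
      integralClosure A (MvPolynomial (Fin n) K) := fun i =>
    ih i (hk ▸ i.2.trans_le (hτ k)) _ (by simp)
  have hC : ∀ c : K, (C c : MvPolynomial (Fin n) K) ∈
      integralClosure A (MvPolynomial (Fin n) K) := fun c =>
    (isIntegral_algebraMap (A := MvPolynomial (Fin n) K) (x := algebraMap K A c))
  have hlin : ∀ c, (initialForm (hn k) c : MvPolynomial (Fin n) K) ∈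
      integralClosure A (MvPolynomial (Fin n) K) := fun c =>
    sum_mem fun i _ => mul_mem (hC _) (hmem i)
  have hw : Fpoly K (τ k) (hn k) (X k) ∈ integralClosure A (MvPolynomial (Fin n) K) :=
    (isIntegral_algebraMap (A := MvPolynomial (Fin n) K)
      (x := (⟨_, Algebra.subset_adjoin ⟨k, rfl⟩⟩ : A)))
  have hB : IsIntegral (integralClosure A (MvPolynomial (Fin n) K))
      (X k : MvPolynomial (Fin n) K) := by
    refine ⟨∏ c : Fin (τ k) → K, (Polynomial.X + Polynomial.C ⟨initialForm (hn k) c, hlin c⟩) -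
      Polynomial.C ⟨_, hw⟩, ?_, ?_⟩
    · have hm : (∏ c : Fin (τ k) → K, (Polynomial.X + Polynomial.C
          (⟨initialForm (hn k) c, hlin c⟩ : integralClosure A (MvPolynomial (Fin n) K)))).Monic :=
        Polynomial.monic_prod_of_monic _ _ fun c _ => Polynomial.monic_X_add_C _
      refine hm.sub_of_left (Polynomial.degree_C_le.trans_lt ?_)
      rw [Polynomial.degree_prod]
      simp only [Polynomial.degree_X_add_C, sum_const, nsmul_one]
      exact_mod_cast (Fintype.card_pos : 0 < Fintype.card (Fin (τ k) → K))
    · rw [Polynomial.eval₂_sub, Polynomial.eval₂_finsetProd]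
      simp [Fpoly_eq]
  exact isIntegral_of_isIntegral_integralClosure hB

/-- The orbit products of the variables under a staircase unipotent group are algebraically
independent. -/
theorem algebraicIndependent_Fpoly (hn : ∀ t, τ t ≤ n) (hτ : ∀ t : Fin n, τ t ≤ t) :
    AlgebraicIndependent K fun t => Fpoly K (τ t) (hn t) (X t) := by
  have hint : Algebra.IsIntegral
      (Algebra.adjoin K (Set.range fun t => Fpoly K (τ t) (hn t) (X t)))
      (MvPolynomial (Fin n) K) := by
    refine ⟨fun f => ?_⟩
    induction f using MvPolynomial.induction_on with
    | C c => exact isIntegral_algebraMap (x := algebraMap K _ c)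
    | add p q hp hq => exact hp.add hq
    | mul_X p i hp => exact hp.mul (isIntegral_X_adjoin_Fpoly hn hτ i)
  refine (Algebra.IsAlgebraic.isTranscendenceBasis_of_lift_le_trdeg_of_finite K _ ?_).1
  simp [MvPolynomial.trdeg_of_isDomain]

/-- The orbit products of the variables generate the invariants of a staircase unipotent group. -/
theorem adjoin_Fpoly_eq_invariants (hn : ∀ t, τ t ≤ n) (hτ : ∀ t : Fin n, τ t ≤ t) :
    Algebra.adjoin K (Set.range fun t => Fpoly K (τ t) (hn t) (X t)) =
      invariants (staircaseUnipotent K τ) := by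
  refine le_antisymm (Algebra.adjoin_le ?_) fun f hf =>
    mem_adjoin_of_mem_invariants hn hτ n f hf fun i _ => i.2
  rintro _ ⟨t, rfl⟩
  exact Fpoly_mem_invariants hτ t (hn t)

end Staircase

section Blocks

variable {l : ℕ} {m : Fin (l + 1) → ℕ}

lemma tauf_le (m : Fin (l + 1) → ℕ) (s : ℕ) : tauf m s ≤ s :=
  Finset.sup_le fun _ hi => (mem_filter.mp hi).2

lemma le_tauf {s : ℕ} {i : Fin (l + 1)} (h : m i ≤ s) : m i ≤ tauf m s :=
  Finset.le_sup (f := m) (mem_filter.mpr ⟨mem_univ _, h⟩)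

lemma exists_tauf_eq (hm0 : m 0 = 0) (s : ℕ) : ∃ i, m i ≤ s ∧ tauf m s = m i := by
  obtain ⟨i, hi, h⟩ := exists_mem_eq_sup
    ((univ : Finset (Fin (l + 1))).filter fun i => m i ≤ s) ⟨0, by simp [hm0]⟩ m
  exact ⟨i, (mem_filter.mp hi).2, h⟩

lemma tauf_le_tauf_iff (hm0 : m 0 = 0) (s t : ℕ) : tauf m t ≤ tauf m s ↔ tauf m t ≤ s := by
  refine ⟨fun h => h.trans (tauf_le m s), fun h => ?_⟩
  obtain ⟨i, -, hi⟩ := exists_tauf_eq hm0 t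
  rw [hi] at h ⊢
  exact le_tauf h

lemma tauf_emb {n : ℕ} (hmono : StrictMono m) (hlast : m (Fin.last l) = n) (i : Fin l)
    (j : Fin (m i.succ - m i.castSucc)) :
    tauf m (emb n m hmono hlast i j) = m i.castSucc := by
  refine le_antisymm (Finset.sup_le fun a ha => ?_) (le_tauf (Nat.le_add_right _ _))
  have h := (mem_filter.mp ha).2
  have hj := j.2
  simp only [emb] at h
  have : a < i.succ := hmono.lt_iff_lt.mp (by omega)
  exact hmono.monotone (Fin.le_castSucc_iff.mpr this)

lemma emb_bijective {n : ℕ} (hm0 : m 0 = 0) (hmono : StrictMono m)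
    (hlast : m (Fin.last l) = n) :
    Function.Bijective fun x : Σ i : Fin l, Fin (m i.succ - m i.castSucc) =>
      emb n m hmono hlast x.1 x.2 := by
  constructor
  · rintro ⟨i, j⟩ ⟨i', j'⟩ h
    have h' := congrArg (fun t : Fin n => tauf m t) h
    simp only [tauf_emb] at h'
    obtain rfl := Fin.castSucc_injective _ (hmono.injective h')
    have h2 := congrArg Fin.val h
    simp only [emb, add_right_inj] at h2
    rw [Fin.ext h2]
  · intro t
    obtain ⟨a, ha, hta⟩ := exists_tauf_eq hm0 t
    have ht := t.2
    obtain ⟨i, rfl⟩ := Fin.exists_castSucc_eq.mpr (show a ≠ Fin.last l by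
      rintro rfl
      omega)
    have hlt : (t : ℕ) < m i.succ := by
      by_contra! h
      have h1 := le_tauf h
      rw [hta] at h1
      exact absurd (hmono i.castSucc_lt_succ) (not_lt.mpr h1)
    refine ⟨⟨i, ⟨t - m i.castSucc, by omega⟩⟩, Fin.ext ?_⟩
    simp only [emb]
    omega

lemma USet_eq_staircaseUnipotent (K : Type*) [Field K] {n : ℕ} (hm0 : m 0 = 0) :
    USet K n m = staircaseUnipotent K fun t => tauf m t := by
  ext g
  simp only [USet, staircaseUnipotent, Set.mem_ofPred_eq, tauf_le_tauf_iff hm0]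

lemma vij_eq_Fpoly_tauf (K : Type*) [Field K] [Fintype K] {n : ℕ} (hmono : StrictMono m)
    (hlast : m (Fin.last l) = n) (i : Fin l) (j : Fin (m i.succ - m i.castSucc)) :
    vij K n m hmono hlast i j = Fpoly K (tauf m (emb n m hmono hlast i j))
      ((tauf_le m _).trans (emb n m hmono hlast i j).2.le) (X (emb n m hmono hlast i j)) := by
  simp only [vij, tauf_emb]

end Blocks

/-- for a composition `I = (n_1, …, n_l)` of `n` (encoded by the
strictly increasing sequence of partial sums `m : Fin (l+1) → ℕ` with `m 0 = 0`
and `m l = n`), the invariant ring `P^{U_I}` is the polynomial algebra on the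
`n` elements `v_{i,j}` (`1 ≤ i ≤ l`, `1 ≤ j ≤ n_i`); i.e. these elements are
algebraically independent over `F_q` and generate `P^{U_I}` as an `F_q`-algebra. -/
theorem statement1 {K : Type*} [Field K] [Fintype K] {p r : ℕ} (hp : p.Prime)
    (hr : 0 < r) (hcard : Fintype.card K = p ^ r)
    (n l : ℕ) (hl : 0 < l) (m : Fin (l + 1) → ℕ)
    (hm0 : m 0 = 0) (hmono : StrictMono m) (hlast : m (Fin.last l) = n) :
    AlgebraicIndependent K
      (fun x : Σ i : Fin l, Fin (m i.succ - m i.castSucc) =>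
        vij K n m hmono hlast x.1 x.2) ∧
    Algebra.adjoin K
      (Set.range (fun x : Σ i : Fin l, Fin (m i.succ - m i.castSucc) =>
        vij K n m hmono hlast x.1 x.2)) = invariants (USet K n m) := by
  have hn : ∀ t : Fin n, tauf m t ≤ n := fun t => (tauf_le m t).trans t.2.le
  have hτ : ∀ t : Fin n, tauf m t ≤ t := fun t => tauf_le m t
  have hbij := emb_bijective hm0 hmono hlast
  have hv : (fun x : Σ i : Fin l, Fin (m i.succ - m i.castSucc) =>
      vij K n m hmono hlast x.1 x.2) =
      (fun t : Fin n => Fpoly K (tauf m t) (hn t) (X t)) ∘ fun x => emb n m hmono hlast x.1 x.2 :=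
    funext fun x => vij_eq_Fpoly_tauf K hmono hlast x.1 x.2
  rw [hv, hbij.surjective.range_comp, USet_eq_staircaseUnipotent K hm0]
  exact ⟨(algebraicIndependent_Fpoly hn hτ).comp _ hbij.injective,
    adjoin_Fpoly_eq_invariants hn hτ⟩
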